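/- Let k ≥ 4 and let w be a minimal uncompletable word for S_k. Let p be an occurrence of v and q an occurrence of u in w such that p and q are consecutive with p before q, and let F_p, F_q be their sets of forbidden positions. If F_q = {0} ∪ {i, i+1, …, k−1} for some 1 ≤ i ≤ k−1 and |F_p| = |F_q|, then the two occurrences overlap (q starts k − 2 positions after p) and F_p = {0} ∪ {i−1, i, …, k−2}. -/

import Mathlib

namespace Restivo

/-- Words over the two-letter alphabet Σ = {a, b}, encoded as lists of booleans. -/
abbrev Word := List Bool

/-- The letter `a`. -/
def a : Bool := false

/-- The letter `b`. -/
def b : Bool := true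

/-- Kleene star: all finite concatenations of words from `S` (including the empty word). -/
def kstar (S : Set Word) : Set Word :=
  { w | ∃ L : List Word, (∀ x ∈ L, x ∈ S) ∧ L.flatten = w }

/-- Prefixes of words of `L`. -/
def Pref (L : Set Word) : Set Word := { w | ∃ z : Word, w ++ z ∈ L }

/-- Factors (contiguous subwords) of words of `L`. -/
def Facts (L : Set Word) : Set Word := { w | ∃ x y : Word, x ++ w ++ y ∈ L }

/-- The word u = b a^(k-1). -/
def u (k : ℕ) : Word := b :: List.replicate (k - 1) a

/-- The word v = b^(k-1) a. -/
def v (k : ℕ) : Word := List.replicate (k - 1) b ++ [a]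

/-- The set S_k = (Σ^k \ {u, v}) ∪ (Σ^(k-1) \ {a^(k-1), b^(k-1)}). -/
def Sk (k : ℕ) : Set Word :=
  { w | w.length = k ∧ w ≠ u k ∧ w ≠ v k } ∪
  { w | w.length = k - 1 ∧ w ≠ List.replicate (k - 1) a ∧ w ≠ List.replicate (k - 1) b }

/-- Position `j` is forbidden in `w` w.r.t. `S` if the suffix of `w` starting from
position `j` is not a prefix of any word of `S*`. -/
def Forbidden (S : Set Word) (w : Word) (j : ℕ) : Prop :=
  w.drop j ∉ Pref (kstar S)

/-- The word `p` occurs in `w` at position `s`. -/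
def OccursAt (p w : Word) (s : ℕ) : Prop :=
  s + p.length ≤ w.length ∧ (w.drop s).take p.length = p

/-- The set of (locally enumerated) forbidden positions of the occurrence of `p`
at position `s` in `w`, with respect to `S_k`. -/
def Focc (k : ℕ) (w p : Word) (s : ℕ) : Set ℕ :=
  { i | i < p.length ∧ Forbidden (Sk k) w (s + i) }

/-- Two occurrences (of words from {u, v}) at positions `s < t` in `w` are
consecutive: no word from {u, v} occurs at a position strictly between them. -/
def Consecutive (k : ℕ) (w : Word) (s t : ℕ) : Prop :=
  s < t ∧ ∀ m, s < m → m < t → ¬ OccursAt (u k) w m ∧ ¬ OccursAt (v k) w m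

/-- `w` is a minimal uncompletable word for `S`. -/
def MinUncompletable (S : Set Word) (w : Word) : Prop :=
  w ∉ Facts (kstar S) ∧ ∀ w' : Word, w' ∉ Facts (kstar S) → w.length ≤ w'.length

theorem occursAt_iff (p w : Word) (s : ℕ) :
    OccursAt p w s ↔ s + p.length ≤ w.length ∧ ∀ x < p.length, w[s + x]? = p[x]? := by
  unfold OccursAt
  refine and_congr_right fun h => ?_
  rw [List.ext_getElem?_iff]
  refine ⟨fun H x hx => ?_, fun H x => ?_⟩
  · rw [← H x, List.getElem?_take_of_lt hx, List.getElem?_drop]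
  · by_cases hx : x < p.length
    · rw [← H x hx, List.getElem?_take_of_lt hx, List.getElem?_drop]
    · rw [List.getElem?_eq_none (by simp; omega), List.getElem?_eq_none (by omega)]

theorem length_u {k : ℕ} (hk : 1 ≤ k) : (u k).length = k := by
  simp [u]; omega

theorem length_v {k : ℕ} (hk : 1 ≤ k) : (v k).length = k := by
  simp [v]; omega

theorem occursAt_u_iff {k : ℕ} (hk : 1 ≤ k) (w : Word) (s : ℕ) :
    OccursAt (u k) w s ↔
      s + k ≤ w.length ∧ w[s]? = some b ∧ ∀ x, 1 ≤ x → x < k → w[s + x]? = some a := by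
  rw [occursAt_iff, length_u hk]
  refine and_congr_right fun _ => ⟨fun H => ⟨?_, fun x h1 h2 => ?_⟩, fun H x hx => ?_⟩
  · simpa [u] using H 0 (by omega)
  · obtain ⟨y, rfl⟩ : ∃ y, x = y + 1 := ⟨x - 1, by omega⟩
    rw [H _ h2]
    simp [u, List.getElem?_replicate]; omega
  · rcases x with _ | y
    · simpa [u] using H.1
    · rw [H.2 _ (by omega) hx]
      simp [u, List.getElem?_replicate]; omega

theorem occursAt_v_iff {k : ℕ} (hk : 1 ≤ k) (w : Word) (s : ℕ) :
    OccursAt (v k) w s ↔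
      s + k ≤ w.length ∧ w[s + (k - 1)]? = some a ∧ ∀ x < k - 1, w[s + x]? = some b := by
  rw [occursAt_iff, length_v hk]
  have hb : ∀ x < k - 1, (v k)[x]? = some b := fun x hx => by
    rw [v, List.getElem?_append_left (by simpa using hx)]
    simp [hx]
  have ha : (v k)[k - 1]? = some a := by
    rw [v, List.getElem?_append_right (by simp)]
    simp
  refine and_congr_right fun _ => ⟨fun H => ⟨?_, fun x hx => ?_⟩, fun H x hx => ?_⟩
  · rw [H _ (by omega), ha]
  · rw [H _ (by omega), hb x hx]
  · by_cases h : x < k - 1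
    · rw [H.2 x h, hb x h]
    · obtain rfl : x = k - 1 := by omega
      rw [H.1, ha]

theorem letter_eq_a_or_b {w : Word} {j : ℕ} (hj : j < w.length) :
    w[j]? = some a ∨ w[j]? = some b := by
  rw [List.getElem?_eq_getElem hj]
  cases w[j] <;> simp [a, b]

/-- If the `m` letters of `w` from position `j` on form `c^m`, each of them is `c`. -/
theorem getElem?_of_take_eq_replicate {w : Word} {j m : ℕ} {c : Bool}
    (h : (w.drop j).take m = List.replicate m c) : ∀ x < m, w[j + x]? = some c := by
  intro x hx
  rw [← List.getElem?_drop, ← List.getElem?_take_of_lt hx, h]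
  simp [hx]

theorem length_of_mem_Sk {k : ℕ} {x : Word} (hx : x ∈ Sk k) : x.length = k ∨ x.length = k - 1 := by
  rcases hx with h | h
  · exact Or.inl h.1
  · exact Or.inr h.1

theorem append_mem_kstar {S : Set Word} {x y : Word} (hx : x ∈ S) (hy : y ∈ kstar S) :
    x ++ y ∈ kstar S := by
  obtain ⟨L, hL, rfl⟩ := hy
  exact ⟨x :: L, by simpa using ⟨hx, hL⟩, by simp⟩

theorem Forbidden.add_of_mem {S : Set Word} {w : Word} {j m : ℕ} (h : Forbidden S w j)
    (hm : (w.drop j).take m ∈ S) : Forbidden S w (j + m) := by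
  rintro ⟨z, hz⟩
  refine h ⟨z, ?_⟩
  have := append_mem_kstar hm hz
  rwa [← List.append_assoc, ← List.drop_drop, List.take_append_drop] at this

/-- If a suffix of length at least `k` is not forbidden, a word of `S_k` can be split off it. -/
theorem exists_take_mem_of_not_forbidden {k : ℕ} (hk : 1 ≤ k) {w : Word} {j : ℕ}
    (hj : j + k ≤ w.length) (h : ¬ Forbidden (Sk k) w j) :
    ∃ m, (m = k ∨ m = k - 1) ∧ (w.drop j).take m ∈ Sk k ∧ ¬ Forbidden (Sk k) w (j + m) := by
  simp only [Forbidden, not_not] at h ⊢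
  obtain ⟨z, L, hL, hz⟩ := h
  rcases L with _ | ⟨x, L⟩
  · have := congrArg List.length hz
    simp at this
    omega
  · have hx : x ∈ Sk k := hL x (by simp)
    have hlen := length_of_mem_Sk hx
    have hle : x.length ≤ (w.drop j).length := by simp; omega
    rw [List.flatten_cons] at hz
    have h1 : (w.drop j).take x.length = x := by
      rw [← List.take_append_of_le_length hle, ← hz, List.take_left]
    have h2 : L.flatten = w.drop (j + x.length) ++ z := by
      have := congrArg (List.drop x.length) hz
      rwa [List.drop_left, List.drop_append_of_le_length hle, List.drop_drop] at this
    exact ⟨x.length, hlen, by rwa [h1], z, L, fun y hy => hL y (by simp [hy]), h2⟩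

theorem forbidden_of_occursAt_v {k : ℕ} (hk : 1 ≤ k) {w : Word} {s : ℕ}
    (h : OccursAt (v k) w s) : Forbidden (Sk k) w s := by
  have hlen := length_v hk
  have h1 := h.1
  have h2 := h.2
  rw [hlen] at h1 h2
  by_contra hf
  obtain ⟨m, rfl | rfl, hm, -⟩ := exists_take_mem_of_not_forbidden hk h1 hf
  · rcases hm with hm | hm
    · exact hm.2.2 h2
    · have := hm.1
      rw [h2, hlen] at this
      omega
  · have h3 : (w.drop s).take (k - 1) = List.replicate (k - 1) b := by
      have : (w.drop s).take (k - 1) = ((w.drop s).take k).take (k - 1) := by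
        rw [List.take_take, min_eq_left (by omega)]
      rw [this, h2, v, List.take_left' (by simp)]
    rcases hm with hm | hm
    · have := hm.1
      rw [h3, List.length_replicate] at this
      omega
    · exact hm.2.2 h3

section Between

variable {k : ℕ} {w : Word} {s t : ℕ}

theorem not_a_run_between (hk : 4 ≤ k) (hop : OccursAt (v k) w s) (hoq : OccursAt (u k) w t)
    (hcons : Consecutive k w s t) (j : ℕ) (hsj : s < j) (hjt : j < t) :
    ¬ ∀ x < k - 1, w[j + x]? = some a := by
  rw [occursAt_v_iff (by omega)] at hop
  rw [occursAt_u_iff (by omega)] at hoq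
  induction j with
  | zero => omega
  | succ j ih =>
    intro H
    have hshift : ∀ x, 1 ≤ x → x < k → w[j + x]? = some a := fun x h1 h2 => by
      have := H (x - 1) (by omega)
      rwa [show j + 1 + (x - 1) = j + x by omega] at this
    have hsj' : s < j := by
      rcases Nat.lt_succ_iff_lt_or_eq.1 hsj with h | h
      · exact h
      · subst h
        have h1 := hop.2.2 1 (by omega)
        rw [hshift 1 le_rfl (by omega)] at h1
        simp [a, b] at h1
    rcases letter_eq_a_or_b (w := w) (j := j) (by omega) with h | h
    · refine ih hsj' (by omega) fun x hx => ?_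
      rcases Nat.eq_zero_or_pos x with rfl | hx0
      · exact h
      · exact hshift x hx0 (by omega)
    · exact (hcons.2 j hsj' (by omega)).1
        ((occursAt_u_iff (by omega) _ _).2 ⟨by omega, h, hshift⟩)

theorem not_b_run_between (hk : 4 ≤ k) (hoq : OccursAt (u k) w t)
    (hcons : Consecutive k w s t) (j : ℕ) (hsj : s < j) (hjt : j < t) :
    ¬ ∀ x < k - 1, w[j + x]? = some b := by
  rw [occursAt_u_iff (by omega)] at hoq
  induction h : t - j generalizing j with
  | zero => omega
  | succ e ih =>
    intro H
    rcases letter_eq_a_or_b (w := w) (j := j + (k - 1)) (by omega) with h' | h'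
    · exact (hcons.2 j hsj hjt).2 ((occursAt_v_iff (by omega) _ _).2 ⟨by omega, h', H⟩)
    · by_cases hjt' : j + 1 = t
      · have h1 := H 2 (by omega)
        rw [show j + 2 = t + 1 by omega, hoq.2.2 1 le_rfl (by omega)] at h1
        simp [a, b] at h1
      · refine ih (j + 1) (by omega) (by omega) (by omega) fun x hx => ?_
        rw [show j + 1 + x = j + (x + 1) by omega]
        by_cases hx' : x + 1 < k - 1
        · exact H _ hx'
        · rwa [show x + 1 = k - 1 by omega]

theorem forbidden_iff_between (hk : 4 ≤ k) (hop : OccursAt (v k) w s)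
    (hoq : OccursAt (u k) w t) (hcons : Consecutive k w s t) (j : ℕ) (hsj : s < j)
    (hjt : j < t) :
    Forbidden (Sk k) w j ↔ Forbidden (Sk k) w (j + k) ∧ Forbidden (Sk k) w (j + (k - 1)) := by
  have htk := ((occursAt_u_iff (by omega) _ _).1 hoq).1
  have hlong : (w.drop j).take k ∈ Sk k := by
    refine Or.inl ⟨by simp; omega, fun h => ?_, fun h => ?_⟩
    · exact (hcons.2 j hsj hjt).1 ⟨by rw [length_u] <;> omega, by rwa [length_u (by omega)]⟩
    · exact (hcons.2 j hsj hjt).2 ⟨by rw [length_v] <;> omega, by rwa [length_v (by omega)]⟩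
  have hshort : (w.drop j).take (k - 1) ∈ Sk k := by
    refine Or.inr ⟨by simp; omega, fun h => ?_, fun h => ?_⟩
    · exact not_a_run_between hk hop hoq hcons j hsj hjt (getElem?_of_take_eq_replicate h)
    · exact not_b_run_between hk hoq hcons j hsj hjt (getElem?_of_take_eq_replicate h)
  refine ⟨fun h => ⟨h.add_of_mem hlong, h.add_of_mem hshort⟩, fun ⟨h1, h2⟩ => ?_⟩
  by_contra hf
  obtain ⟨m, rfl | rfl, -, hm⟩ := exists_take_mem_of_not_forbidden (by omega) (by omega) hf
  · exact hm h1
  · exact hm h2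

end Between

/-- A cut of a factorization occurs among the first `k` positions of any suffix. -/
theorem exists_drop_mem_kstar {S : Set Word} {k : ℕ} (hk : 1 ≤ k) (hS : ∀ x ∈ S, x.length ≤ k)
    (L : List Word) (hL : ∀ x ∈ L, x ∈ S) (x z : Word) (h : L.flatten = x ++ z) :
    ∃ j < k, z.drop j ∈ kstar S := by
  induction L generalizing x with
  | nil =>
    have : z = [] := by simp at h; exact h.2
    exact ⟨0, by omega, [], by simp, by simp [this]⟩
  | cons y L ih =>
    have hL' : ∀ x ∈ L, x ∈ S := fun x hx => hL x (by simp [hx])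
    rcases x with _ | ⟨c, x⟩
    · exact ⟨0, by omega, y :: L, hL, by simpa using h⟩
    rw [List.flatten_cons, List.append_eq_append_iff] at h
    rcases h with ⟨x', -, h⟩ | ⟨z', hy, h⟩
    · exact ih hL' x' h
    · refine ⟨z'.length, ?_, L, hL', by simp [h]⟩
      have := hS y (hL y (by simp))
      rw [hy] at this
      simp at this
      omega

theorem not_mem_Facts_of_forbidden {S : Set Word} {k : ℕ} (hk : 1 ≤ k)
    (hS : ∀ x ∈ S, x.length ≤ k) {w : Word} (hw : k ≤ w.length)
    (h : ∀ j < k, Forbidden S w j) : w ∉ Facts (kstar S) := by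
  rintro ⟨x, y, L, hL, hxy⟩
  obtain ⟨j, hj, hmem⟩ :=
    exists_drop_mem_kstar hk hS L hL x (w ++ y) (by rw [hxy, List.append_assoc])
  rw [List.drop_append_of_le_length (by omega)] at hmem
  exact h j hj ⟨y, hmem⟩

/-- The windows of length `k` at `s` and `t` contain different numbers of elements of `f` when they
are disjoint and `f` obeys the generic recurrence strictly between `s` and `t`. -/
theorem count_window_ne (f : ℕ → Prop) [DecidablePred f] {k s t i : ℕ} (hi : 2 ≤ i)
    (hik : i ≤ k - 1) (hst : s + k ≤ t)
    (hrec : ∀ j, s < j → j < t → (f j ↔ f (j + k) ∧ f (j + (k - 1))))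
    (hq : ∀ x < k, f (t + x) ↔ x = 0 ∨ i ≤ x) :
    Nat.count f (s + k) + Nat.count f t ≠ Nat.count f (t + k) + Nat.count f s := by
  have hstep : ∀ m, Nat.count f (m + 1 + k) + Nat.count f m + (if f m then 1 else 0) =
      Nat.count f (m + k) + Nat.count f (m + 1) + (if f (m + k) then 1 else 0) := fun m => by
    rw [show m + 1 + k = m + k + 1 by omega, Nat.count_succ, Nat.count_succ]
    omega
  have hmono : ∀ n m, s < m → m ≤ n → n ≤ t →
      Nat.count f (m + k) + Nat.count f n ≤ Nat.count f (n + k) + Nat.count f m := by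
    intro n m hsm hmn
    induction n, hmn using Nat.le_induction with
    | base => intro _; omega
    | succ n hmn ih =>
      intro hnt
      have h1 := ih (by omega)
      have h2 := hstep n
      have h3 : f n → f (n + k) := fun h => ((hrec n (by omega) (by omega)).1 h).1
      split_ifs at h2 <;> first | omega | tauto
  have hdrop : ∀ m, s < m → m < t → f (m + k) → ¬ f m →
      Nat.count f (m + k) + Nat.count f (m + 1) + 1 =
        Nat.count f (m + 1 + k) + Nat.count f m := fun m _ _ h1 h2 => by
    have := hstep m
    simp only [h1, h2, if_true, if_false] at this
    omega
  have hbelow : ∀ x, 1 ≤ x → x < k → (f (t + x - k) ↔ i + 1 ≤ x) := fun x h1 h2 => by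
    rw [hrec _ (by omega) (by omega), show t + x - k + k = t + x by omega,
      show t + x - k + (k - 1) = t + (x - 1) by omega, hq x h2, hq (x - 1) (by omega)]
    omega
  have hd1 := hdrop (t + i - k) (by omega) (by omega)
    (by rw [show t + i - k + k = t + i by omega, hq i (by omega)]; omega)
    (by rw [hbelow i (by omega) (by omega)]; omega)
  have hm1 := hmono t (t + i - k + 1) (by omega) (by omega) le_rfl
  have hs := hstep s
  have hm2 := hmono (t + i - k) (s + 1) (by omega) (by omega) (by omega)
  by_cases hsk : f (s + k)
  · simp only [hsk, if_true] at hs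
    split_ifs at hs <;> omega
  · have hfar : s + 2 * k ≤ t + i := by
      by_contra hlt
      refine hsk ?_
      by_cases h : s + k = t
      · rw [h]
        exact (hq 0 (by omega)).2 (Or.inl rfl)
      · rw [show s + k = t + (s + 2 * k - t) - k by omega, hbelow _ (by omega) (by omega)]
        omega
    have hne : s + k ≠ t := by
      rintro h
      exact hsk (h ▸ (hq 0 (by omega)).2 (Or.inl rfl))
    have hfi : f (t + (i + 1) - k) := by
      by_cases h : i + 1 < k
      · exact (hbelow _ (by omega) h).2 le_rfl
      · rw [show t + (i + 1) - k = t + 0 by omega]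
        exact (hq 0 (by omega)).2 (Or.inl rfl)
    have hd2 := hdrop (t + (i + 1) - 2 * k) (by omega) (by omega)
      (by rwa [show t + (i + 1) - 2 * k + k = t + (i + 1) - k by omega])
      (by
        rw [hrec _ (by omega) (by omega),
          show t + (i + 1) - 2 * k + (k - 1) = t + i - k by omega, hbelow i (by omega) (by omega)]
        omega)
    have hm3 := hmono (t + (i + 1) - 2 * k) (s + 1) (by omega) (by omega) (by omega)
    have hm4 := hmono (t + i - k) (t + (i + 1) - 2 * k + 1) (by omega) (by omega) (by omega)
    simp only [hsk, if_false] at hs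
    split_ifs at hs <;> omega

open Classical in
theorem count_add_ncard_Focc (k : ℕ) (w p : Word) (s : ℕ) :
    Nat.count (Forbidden (Sk k) w) s + (Focc k w p s).ncard =
      Nat.count (Forbidden (Sk k) w) (s + p.length) := by
  rw [Nat.count_add, Nat.count_eq_card_filter_range (fun i => Forbidden (Sk k) w (s + i)),
    ← Set.ncard_coe_finset]
  congr 2
  ext i
  simp [Focc]

theorem statement15 (k : ℕ) (hk : 4 ≤ k) (w : Word)
    (hw : MinUncompletable (Sk k) w)
    (s t : ℕ) (hop : OccursAt (v k) w s) (hoq : OccursAt (u k) w t)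
    (hcons : Consecutive k w s t)
    (i : ℕ) (hi1 : 1 ≤ i) (hi2 : i ≤ k - 1)
    (hFq : Focc k w (u k) t = insert 0 (Set.Icc i (k - 1)))
    (hcard : (Focc k w (v k) s).ncard = (Focc k w (u k) t).ncard) :
    t = s + (k - 2) ∧ Focc k w (v k) s = insert 0 (Set.Icc (i - 1) (k - 2)) := by
  classical
  have hq : ∀ x < k, Forbidden (Sk k) w (t + x) ↔ x = 0 ∨ i ≤ x := fun x hx => by
    have := Set.ext_iff.1 hFq x
    simp only [Focc, length_u (show 1 ≤ k by omega), Set.mem_ofPred_eq, hx, true_and,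
      Set.mem_insert_iff, Set.mem_Icc] at this
    rw [this]
    omega
  have hrec := forbidden_iff_between hk hop hoq hcons
  have hst := hcons.1
  obtain ⟨hsn, hva, hvb⟩ := (occursAt_v_iff (by omega) _ _).1 hop
  obtain ⟨htn, hub, hua⟩ := (occursAt_u_iff (by omega) _ _).1 hoq
  have hi : 2 ≤ i := by
    by_contra hlt
    have hunc : w.drop t ∉ Facts (kstar (Sk k)) := by
      refine not_mem_Facts_of_forbidden (k := k) (by omega)
        (fun x hx => by have := length_of_mem_Sk hx; omega) (by simp; omega) fun j hj => ?_
      have := (hq j hj).2 (by omega)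
      rwa [Forbidden, ← List.drop_drop] at this
    have := hw.2 _ hunc
    simp at this
    omega
  have hlt : t < s + k := by
    by_contra hge
    refine count_window_ne (Forbidden (Sk k) w) hi hi2 (by omega) hrec hq ?_
    have h1 := count_add_ncard_Focc k w (v k) s
    have h2 := count_add_ncard_Focc k w (u k) t
    rw [length_v (by omega)] at h1
    rw [length_u (by omega)] at h2
    omega
  have ht : t = s + (k - 2) := by
    by_cases h1 : t = s + (k - 1)
    · rw [← h1, hub] at hva
      simp [a, b] at hva
    · by_contra h2
      have h3 := hvb (t + 1 - s) (by omega)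
      rw [show s + (t + 1 - s) = t + 1 by omega, hua 1 le_rfl (by omega)] at h3
      simp [a, b] at h3
  refine ⟨ht, Set.ext fun x => ?_⟩
  simp only [Focc, length_v (show 1 ≤ k by omega), Set.mem_ofPred_eq, Set.mem_insert_iff,
    Set.mem_Icc]
  rcases Nat.eq_zero_or_pos x with rfl | hx0
  · simpa using ⟨by omega, forbidden_of_occursAt_v (by omega) hop⟩
  by_cases hxk : x < k
  · by_cases hxt : s + x < t
    · rw [hrec _ (by omega) hxt, show s + x + k = t + (x + 2) by omega,
        show s + x + (k - 1) = t + (x + 1) by omega, hq (x + 1) (by omega)]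
      by_cases hx2 : x + 2 < k
      · rw [hq _ hx2]
        omega
      · omega
    · rw [show s + x = t + (x - (k - 2)) by omega, hq _ (by omega)]
      omega
  · omega

end Restivo
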